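/- arXiv:1703.08879 — 2 statements merged into one kernel-verified Lean document; each statement's English description precedes it below -/
import Mathlib

section
/- Let X be a Polish space and A ⊆ X be residually null. If the annihilator 𝓝(A) is either an analytic or a coanalytic subset of 𝓜(X), then A is meager in X. -/
open MeasureTheory Set Topology
open scoped ENNReal symmDiff

/-- The annihilator of a set `A`: the set of Borel probability measures `μ` on `X`
whose induced outer measure vanishes on `A`. -/
def Annihilator {X : Type*} [MeasurableSpace X] (A : Set X) :
    Set (ProbabilityMeasure X) :=
  {μ : ProbabilityMeasure X | μ.toMeasure A = 0}

/-- `A` is residually null if its annihilator is comeager in the space `𝓜(X)` of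
Borel probability measures with the topology of weak convergence. -/
def ResiduallyNull {X : Type*} [TopologicalSpace X] [MeasurableSpace X]
    [OpensMeasurableSpace X] (A : Set X) : Prop :=
  Annihilator A ∈ residual (ProbabilityMeasure X)

open Filter TopologicalSpace

section Hull

variable {X : Type*} [TopologicalSpace X] [SecondCountableTopology X]

/-- In a second countable space, every set is covered up to a meagre set by an open subset of its
closure on which it is everywhere nonmeagre. -/
lemma exists_isOpen_meagre_diff (B : Set X) :
    ∃ O : Set X, IsOpen O ∧ O ⊆ closure B ∧ IsMeagre (B \ O) ∧
      ∀ U, IsOpen U → U.Nonempty → U ⊆ O → ¬ IsMeagre (B ∩ U) := by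
  set V : Set X := ⋃ U ∈ {U ∈ countableBasis X | IsMeagre (B ∩ U)}, U with hV
  have hVopen : IsOpen V :=
    isOpen_biUnion fun U hU => isOpen_of_mem_countableBasis hU.1
  have hsub : ∀ U, IsOpen U → IsMeagre (B ∩ U) → U ⊆ V := by
    intro U hU hm x hx
    obtain ⟨W, hW, hxW, hWU⟩ := (isBasis_countableBasis X).exists_subset_of_mem_open hx hU
    exact mem_biUnion (show W ∈ {U ∈ countableBasis X | IsMeagre (B ∩ U)} from
      ⟨hW, hm.mono (inter_subset_inter_right B hWU)⟩) hxW
  have hBV : IsMeagre (B ∩ V) := by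
    rw [hV, inter_iUnion₂]
    exact isMeagre_biUnion ((countable_countableBasis X).mono (sep_subset _ _)) fun U hU => hU.2
  refine ⟨interior Vᶜ, isOpen_interior, ?_, ?_, ?_⟩
  · refine interior_subset.trans ?_
    rw [compl_subset_comm]
    refine hsub _ isClosed_closure.isOpen_compl ?_
    rw [(disjoint_compl_right.mono_left subset_closure).inter_eq]
    exact IsMeagre.empty
  · have hfr : IsMeagre (frontier Vᶜ) := by
      refine IsNowhereDense.isMeagre ?_
      rw [IsNowhereDense, isClosed_frontier.closure_eq, interior_frontier hVopen.isClosed_compl]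
    refine (hBV.union hfr).mono ?_
    rintro x ⟨hxB, hx⟩
    by_cases hxV : x ∈ V
    · exact Or.inl ⟨hxB, hxV⟩
    · exact Or.inr ⟨subset_closure hxV, hx⟩
  · rintro U hU ⟨x, hx⟩ hUO hm
    exact interior_subset (hUO hx) (hsub U hU hm hx)

end Hull

open PiNat in
/-- The range of a continuous map on the Baire space has the property of Baire. -/
lemma baireMeasurableSet_range {X : Type*} [TopologicalSpace X] [SecondCountableTopology X]
    [T3Space X] {f : (ℕ → ℕ) → X} (hf : Continuous f) : BaireMeasurableSet (range f) := by
  let C : List ℕ → Set (ℕ → ℕ) := fun s => {y | res y s.length = s}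
  choose O hO hOcl hOm hOn using fun s => exists_isOpen_meagre_diff (f '' C s)
  have hC : ∀ s, C s ⊆ ⋃ n, C (n :: s) := by
    intro s y hy
    refine mem_iUnion.2 ⟨y s.length, ?_⟩
    simpa [C] using hy
  have hQ : ∀ s, IsMeagre (O s \ ⋃ n, O (n :: s)) := by
    intro s
    set W := ⋃ n, O (n :: s)
    have hW : IsOpen W := isOpen_iUnion fun n => hO _
    have hsub : O s ⊆ closure W := by
      by_contra hcon
      obtain ⟨x, hx, hxW⟩ := not_subset.1 hcon
      refine hOn s (O s \ closure W) ((hO s).sdiff isClosed_closure) ⟨x, hx, hxW⟩ sdiff_subset ?_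
      refine (isMeagre_iUnion fun n => hOm (n :: s)).mono ?_
      rintro _ ⟨⟨y, hy, rfl⟩, -, hyW⟩
      obtain ⟨n, hn⟩ := mem_iUnion.1 (hC s hy)
      exact mem_iUnion.2 ⟨n, mem_image_of_mem f hn,
        fun h => hyW (subset_closure (mem_iUnion.2 ⟨n, h⟩))⟩
    have hfr : IsMeagre (frontier W) := by
      refine IsNowhereDense.isMeagre ?_
      rw [IsNowhereDense, isClosed_frontier.closure_eq, ← frontier_compl,
        interior_frontier hW.isClosed_compl]
    refine hfr.mono ?_
    rw [hW.frontier_eq]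
    exact sdiff_subset_sdiff_left hsub
  have hdiff : IsMeagre (O [] \ range f) := by
    refine (isMeagre_iUnion hQ).mono ?_
    rintro x ⟨hx, hxf⟩
    by_contra hcon
    have hstep : ∀ s, x ∈ O s → ∃ n, x ∈ O (n :: s) := by
      intro s hs
      by_contra hn
      exact hcon (mem_iUnion.2 ⟨s, hs, fun h => hn (mem_iUnion.1 h)⟩)
    choose g hg using hstep
    let t : ℕ → {s // x ∈ O s} := fun k =>
      Nat.rec ⟨[], hx⟩ (fun _ s => ⟨g s.1 s.2 :: s.1, hg s.1 s.2⟩) k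
    let y : ℕ → ℕ := fun k => g (t k).1 (t k).2
    have hres : ∀ k, res y k = (t k).1 := by
      intro k
      induction k with
      | zero => rfl
      | succ k ih => rw [res_succ, ih]
    refine hxf ⟨y, ?_⟩
    by_contra hne
    have hnhds : {x}ᶜ ∈ 𝓝 (f y) := isOpen_compl_singleton.mem_nhds hne
    obtain ⟨K, hK, hKc, hKx⟩ := exists_mem_nhds_isClosed_subset hnhds
    obtain ⟨k, hk⟩ : ∃ k, cylinder y k ⊆ f ⁻¹' K := by
      have := hf.continuousAt hK
      obtain ⟨_, ⟨z, k, rfl⟩, hy, hsub⟩ :=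
        (isTopologicalBasis_cylinders (fun _ : ℕ => ℕ)).mem_nhds_iff.1 this
      exact ⟨k, by rwa [mem_cylinder_iff_eq.1 hy]⟩
    have hxK : x ∈ closure (f '' C (res y k)) := hOcl _ (by rw [hres]; exact (t k).2)
    refine hKx (closure_minimal ?_ hKc hxK) rfl
    rintro _ ⟨z, hz, rfl⟩
    refine hk ?_
    rw [cylinder_eq_res]
    simpa [C] using hz
  have hrange : IsMeagre (range f \ O []) := by
    have : C [] = univ := by ext; simp [C]
    simpa [this] using hOm []
  have heq : range f = (O [] \ (O [] \ range f)) ∪ (range f \ O []) := by grind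
  rw [heq]
  exact ((hO []).baireMeasurableSet.diff hdiff.baireMeasurableSet).union hrange.baireMeasurableSet

/-- Analytic sets have the property of Baire. -/
lemma MeasureTheory.AnalyticSet.baireMeasurableSet {X : Type*} [TopologicalSpace X]
    [SecondCountableTopology X] [T3Space X] {s : Set X} (hs : AnalyticSet s) :
    BaireMeasurableSet s := by
  rw [AnalyticSet] at hs
  obtain rfl | ⟨f, hf, rfl⟩ := hs
  · exact IsMeagre.empty.baireMeasurableSet
  · exact baireMeasurableSet_range hf

section WeakTopology

variable {X : Type*} [TopologicalSpace X] [MeasurableSpace X] [OpensMeasurableSpace X]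
  [HasOuterApproxClosed X]

lemma isOpen_setOf_lt_measure {U : Set X} (hU : IsOpen U) (c : ℝ≥0∞) :
    IsOpen {μ : ProbabilityMeasure X | c < μ.toMeasure U} := by
  rw [isOpen_iff_mem_nhds]
  intro μ hμ
  exact eventually_lt_of_lt_liminf
    (lt_of_lt_of_le hμ (ProbabilityMeasure.le_liminf_measure_open_of_tendsto tendsto_id hU))

lemma isOpen_setOf_measure_lt {F : Set X} (hF : IsClosed F) (c : ℝ≥0∞) :
    IsOpen {μ : ProbabilityMeasure X | μ.toMeasure F < c} := by
  rw [isOpen_iff_mem_nhds]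
  intro μ hμ
  exact eventually_lt_of_limsup_lt
    (lt_of_le_of_lt (ProbabilityMeasure.limsup_measure_closed_le_of_tendsto tendsto_id hF) hμ)

lemma isGδ_annihilator {F : Set X} (hF : IsClosed F) : IsGδ (Annihilator F) := by
  have : Annihilator F =
      ⋂ n : ℕ, {μ : ProbabilityMeasure X | μ.toMeasure F < ((n : ℝ≥0∞) + 1)⁻¹} := by
    ext μ
    simp only [Annihilator, mem_ofPred_eq, mem_iInter]
    refine ⟨fun h n => by simp [h], fun h => ?_⟩
    by_contra hne
    obtain ⟨n, hn⟩ := ENNReal.exists_inv_nat_lt hne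
    refine lt_irrefl _ (((h n).trans_le ?_).trans hn)
    exact ENNReal.inv_le_inv.2 le_self_add
  rw [this]
  exact IsGδ.iInter_of_isOpen fun n => isOpen_setOf_measure_lt hF _

end WeakTopology

lemma annihilator_iUnion {X ι : Type*} [MeasurableSpace X] [Countable ι] (F : ι → Set X) :
    Annihilator (⋃ i, F i) = ⋂ i, Annihilator (F i) := by
  ext μ
  simp [Annihilator, measure_iUnion_null_iff]

/-- A closed nowhere dense set is annihilated by a dense set of measures. -/
lemma dense_annihilator {X : Type*} [TopologicalSpace X] [PseudoMetrizableSpace X]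
    [SecondCountableTopology X] [MeasurableSpace X] [BorelSpace X] {F : Set X}
    (hF : IsClosed F) (hd : Dense Fᶜ) : Dense (Annihilator F) := by
  let := pseudoMetrizableSpacePseudoMetric X
  intro μ
  have : Nonempty X := nonempty_of_isProbabilityMeasure μ.toMeasure
  obtain ⟨y₀, h₀⟩ := hd.nonempty
  let g : ℕ → X → X := fun n => SimpleFunc.approxOn id measurable_id Fᶜ y₀ h₀ n
  have hg : ∀ n, Measurable (g n) := fun n => SimpleFunc.measurable _
  have hlim : TendstoInDistribution g atTop id (fun _ => μ.toMeasure) μ.toMeasure :=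
    tendstoInDistribution_of_ae_tendsto (fun n => (hg n).aemeasurable) aemeasurable_id
      (ae_of_all _ fun x => SimpleFunc.tendsto_approxOn _ _ (hd x))
  have hid : (⟨μ.toMeasure.map id, Measure.isProbabilityMeasure_map aemeasurable_id⟩ :
      ProbabilityMeasure X) = μ := Subtype.ext Measure.map_id
  refine mem_closure_of_tendsto (hid ▸ hlim.tendsto) (Eventually.of_forall fun n => ?_)
  change μ.toMeasure.map (g n) F = 0
  rw [Measure.map_apply (hg n) hF.measurableSet]
  have : g n ⁻¹' F = ∅ := by
    refine eq_empty_of_forall_notMem fun x hx => ?_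
    exact SimpleFunc.approxOn_mem measurable_id h₀ n x hx
  simp [this]

/-- Meagre sets are residually null. -/
lemma IsMeagre.residuallyNull {X : Type*} [TopologicalSpace X] [PseudoMetrizableSpace X]
    [SecondCountableTopology X] [MeasurableSpace X] [BorelSpace X] {M : Set X}
    (hM : IsMeagre M) : ResiduallyNull M := by
  obtain ⟨S, hSn, hSc, hMS⟩ := isMeagre_iff_countable_union_isNowhereDense.1 hM
  have := hSc.to_subtype
  have hres : (⋂ s : S, Annihilator (closure (s : Set X))) ∈ residual (ProbabilityMeasure X) := by
    refine countable_iInter_mem.2 fun s => ?_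
    have hcl := isClosed_closure (s := (s : Set X))
    refine residual_of_dense_Gδ (isGδ_annihilator hcl) (dense_annihilator hcl ?_)
    rw [← interior_eq_empty_iff_dense_compl]
    exact hSn s s.2
  refine mem_of_superset hres fun μ hμ => ?_
  rw [← annihilator_iUnion] at hμ
  refine measure_mono_null (hMS.trans ?_) hμ
  rintro x ⟨s, hs, hx⟩
  exact mem_iUnion.2 ⟨⟨s, hs⟩, subset_closure hx⟩

/-- The range of an embedding of a completely metrizable space into a metrizable space is a
`Gδ` set. -/
lemma Topology.IsEmbedding.isGδ_range {X Y : Type*} [TopologicalSpace X]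
    [IsCompletelyMetrizableSpace X] [TopologicalSpace Y] [MetrizableSpace Y] {F : X → Y}
    (hF : IsEmbedding F) : IsGδ (range F) := by
  let := upgradeIsCompletelyMetrizable X
  let := metrizableSpaceMetric Y
  let W : ℕ → Set Y := fun n =>
    ⋃₀ {V | IsOpen V ∧ ∀ a b, F a ∈ V → F b ∈ V → dist a b < 1 / ((n : ℝ) + 1)}
  have hW : ∀ n, IsOpen (W n) := fun n => isOpen_sUnion fun V hV => hV.1
  have : range F = closure (range F) ∩ ⋂ n, W n := by
    refine Subset.antisymm (subset_inter subset_closure (subset_iInter fun n => ?_)) ?_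
    · rintro _ ⟨x, rfl⟩
      have hpos : (0 : ℝ) < 1 / ((n : ℝ) + 1) / 2 := by positivity
      obtain ⟨V, hV, hVb⟩ := hF.isInducing.isOpen_iff.1
        (Metric.isOpen_ball (x := x) (ε := 1 / ((n : ℝ) + 1) / 2))
      refine mem_sUnion.2 ⟨V, ⟨hV, fun a b ha hb => ?_⟩, ?_⟩
      · have ha' : a ∈ Metric.ball x (1 / ((n : ℝ) + 1) / 2) := hVb ▸ ha
        have hb' : b ∈ Metric.ball x (1 / ((n : ℝ) + 1) / 2) := hVb ▸ hb
        have := dist_triangle_right a b x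
        rw [Metric.mem_ball] at ha' hb'
        linarith
      · exact (hVb.symm ▸ Metric.mem_ball_self hpos : x ∈ F ⁻¹' V)
    · rintro y ⟨hy, hyW⟩
      have : NeBot (comap F (𝓝 y)) := by
        rw [comap_neBot_iff]
        intro t ht
        obtain ⟨_, hz, x, rfl⟩ := mem_closure_iff_nhds.1 hy t ht
        exact ⟨x, hz⟩
      have hc : Cauchy (comap F (𝓝 y)) := by
        refine Metric.cauchy_iff.2 ⟨inferInstance, fun ε hε => ?_⟩
        obtain ⟨n, hn⟩ := exists_nat_one_div_lt hε
        obtain ⟨V, ⟨hV, hVd⟩, hyV⟩ := mem_sUnion.1 (mem_iInter.1 hyW n)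
        exact ⟨F ⁻¹' V, preimage_mem_comap (hV.mem_nhds hyV),
          fun a ha b hb => (hVd a b ha hb).trans hn⟩
      obtain ⟨x, hx⟩ := CompleteSpace.complete hc
      refine ⟨x, tendsto_nhds_unique (f := F) (l := comap F (𝓝 y)) ?_ tendsto_comap⟩
      exact (hF.continuous.tendsto x).mono_left hx
  rw [this]
  exact isClosed_closure.isGδ.inter (IsGδ.iInter_of_isOpen hW)

section Pushforward

variable {X Y : Type*} [TopologicalSpace X] [MeasurableSpace X] [BorelSpace X]
  [TopologicalSpace Y] [MeasurableSpace Y] [BorelSpace Y]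

/-- Pushing forward along an embedding is an embedding for the weak topologies. -/
lemma Topology.IsEmbedding.probabilityMeasure_map [MetrizableSpace X] [SecondCountableTopology X]
    [MetrizableSpace Y] [SecondCountableTopology Y] {F : X → Y} (hF : IsEmbedding F) :
    IsEmbedding fun μ : ProbabilityMeasure X =>
      μ.map hF.continuous.measurable.aemeasurable := by
  have hind : IsInducing fun μ : ProbabilityMeasure X =>
      μ.map hF.continuous.measurable.aemeasurable := by
    rw [isInducing_iff_nhds]
    intro μ
    refine le_antisymm
      ((ProbabilityMeasure.continuous_map hF.continuous).tendsto μ).le_comap ?_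
    refine tendsto_id'.1 ?_
    refine tendsto_of_forall_isOpen_le_liminf' fun G hG => ?_
    obtain ⟨V, hV, rfl⟩ := hF.isInducing.isOpen_iff.1 hG
    have hmap : ∀ ν : ProbabilityMeasure X,
        (ν.map hF.continuous.measurable.aemeasurable).toMeasure V = ν.toMeasure (F ⁻¹' V) :=
      fun ν => ProbabilityMeasure.map_apply' ν _ hV.measurableSet
    have := ProbabilityMeasure.le_liminf_measure_open_of_tendsto
      (tendsto_comap (f := fun μ : ProbabilityMeasure X =>
        μ.map hF.continuous.measurable.aemeasurable)
        (x := 𝓝 (μ.map hF.continuous.measurable.aemeasurable))) hV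
    simpa only [hmap] using! this
  exact hind.isEmbedding

end Pushforward

/-- The space of probability measures on a Polish space is a Baire space. -/
lemma baireSpace_probabilityMeasure {X : Type*} [TopologicalSpace X] [PolishSpace X]
    [MeasurableSpace X] [BorelSpace X] : BaireSpace (ProbabilityMeasure X) := by
  let := upgradeIsCompletelyMetrizable X
  obtain ⟨F, hF⟩ := Metric.PiNatEmbed.exists_embedding_to_hilbert_cube (X := X)
  have hΦ := hF.probabilityMeasure_map
  set Φ := fun μ : ProbabilityMeasure X => μ.map hF.continuous.measurable.aemeasurable
  obtain ⟨V, hV, hFV⟩ := isGδ_iff_eq_iInter_nat.1 hF.isGδ_range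
  have hme : MeasurableEmbedding F :=
    hF.measurableEmbedding hF.isGδ_range.measurableSet
  have hrange : range Φ = Annihilator (range F)ᶜ := by
    ext ν
    constructor
    · rintro ⟨μ, rfl⟩
      change (μ.toMeasure.map F) (range F)ᶜ = 0
      rw [hme.map_apply]
      simp
    · intro hν
      have hν : ν.toMeasure (range F)ᶜ = 0 := hν
      have heq : (ν.toMeasure.comap F).map F = ν.toMeasure := by
        rw [hme.map_comap, Measure.restrict_eq_self_of_ae_mem]
        exact hν
      have : IsProbabilityMeasure (ν.toMeasure.comap F) := by
        refine ⟨?_⟩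
        rw [← preimage_univ (f := F), ← hme.map_apply, heq]
        exact measure_univ
      exact ⟨⟨ν.toMeasure.comap F, this⟩, Subtype.ext heq⟩
  have hGδ : IsGδ (range Φ) := by
    rw [hrange, hFV, compl_iInter, annihilator_iUnion]
    exact IsGδ.iInter fun n => isGδ_annihilator (hV n).isClosed_compl
  have : BaireSpace (range Φ) := hGδ.baireSpace_of_t2Space_locallyCompactSpace
  exact hΦ.toHomeomorph.symm.baireSpace

/-- If `A` is residually null and its annihilator is analytic or coanalytic,
then `A` is meager. -/
theorem residuallyNull_analytic_annihilator_meager {X : Type*} [TopologicalSpace X]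
    [PolishSpace X] [MeasurableSpace X] [BorelSpace X] (A : Set X)
    (h1 : ResiduallyNull A)
    (h2 : AnalyticSet (Annihilator A) ∨ AnalyticSet (Annihilator A)ᶜ) :
    IsMeagre A := by
  have := baireSpace_probabilityMeasure (X := X)
  have hdirac : (diracProba ⁻¹' Annihilator A : Set X) = Aᶜ := by
    ext x
    simp [Annihilator]
  have hA : BaireMeasurableSet A := by
    obtain h2 | h2 := h2
    · refine BaireMeasurableSet.of_compl ?_
      rw [← hdirac]
      exact (h2.preimage continuous_diracProba).baireMeasurableSet
    · rw [← compl_compl A, ← hdirac, ← preimage_compl]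
      exact (h2.preimage continuous_diracProba).baireMeasurableSet
  obtain ⟨U, hU, hAU⟩ := hA.residualEq_isOpen
  obtain rfl | ⟨x, hx⟩ := U.eq_empty_or_nonempty
  · filter_upwards [hAU] with y hy hyA
    exact hy.mp hyA
  · exfalso
    have hM : IsMeagre (U \ A) := by
      filter_upwards [hAU] with y hy hyU
      exact hyU.2 (hy.mpr hyU.1)
    obtain ⟨μ, hμU, hμA, hμM⟩ :=
      (dense_of_mem_residual (inter_mem h1 hM.residuallyNull)).inter_open_nonempty _
        (isOpen_setOf_lt_measure hU 0) ⟨diracProba x, by simp [hx]⟩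
    refine hμU.ne' (measure_mono_null (t := A ∪ U \ A) ?_ (measure_union_null hμA hμM))
    simp
end

section
/- Let X be a Polish space and A ⊆ X. Then CR(A) equals the closure in X of ICR(A), i.e., CR(A) = cl(int(CR(A))). -/
open MeasureTheory Set Topology
open scoped ENNReal symmDiff

/-- `ROp A` is the union of all open sets `U` such that `U ∩ A` is residually null. -/
def ROp {X : Type*} [TopologicalSpace X] [MeasurableSpace X]
    [OpensMeasurableSpace X] (A : Set X) : Set X :=
  ⋃₀ {U : Set X | IsOpen U ∧ ResiduallyNull (U ∩ A)}

/-- `CROp A = X \ ROp A`. -/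
def CROp {X : Type*} [TopologicalSpace X] [MeasurableSpace X]
    [OpensMeasurableSpace X] (A : Set X) : Set X :=
  (ROp A)ᶜ

open Filter in
/-- Pushing forward along finitely-valued approximations of the identity with values in a dense
set shows that the measures annihilating a measurable set with dense complement are dense. -/
theorem dense_annihilator_of_dense_compl {X : Type*} [TopologicalSpace X] [PolishSpace X]
    [MeasurableSpace X] [BorelSpace X] {F : Set X} (hF : MeasurableSet F) (hd : Dense Fᶜ) :
    Dense (Annihilator F) := by
  let := TopologicalSpace.metrizableSpaceMetric X
  intro μ
  have : Nonempty X := μ.nonempty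
  obtain ⟨y, hy⟩ := hd.nonempty
  let f : ℕ → SimpleFunc X X := SimpleFunc.approxOn id measurable_id Fᶜ y hy
  have hf (x : X) : Tendsto (fun n ↦ f n x) atTop (𝓝 x) :=
    SimpleFunc.tendsto_approxOn measurable_id hy (hd x)
  refine mem_closure_of_tendsto (b := atTop)
    (f := fun n ↦ μ.map (f n).measurable.aemeasurable) ?_ (Eventually.of_forall fun n ↦ ?_)
  · rw [ProbabilityMeasure.tendsto_iff_forall_integral_tendsto]
    intro g
    simp only [ProbabilityMeasure.toMeasure_map]
    have hmap (n : ℕ) : ∫ x, g x ∂(μ.toMeasure.map (f n)) = ∫ x, g (f n x) ∂μ.toMeasure :=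
      integral_map (f n).measurable.aemeasurable g.continuous.aestronglyMeasurable
    simp only [hmap]
    refine tendsto_integral_of_dominated_convergence (fun _ ↦ ‖g‖) (fun n ↦ ?_)
      (integrable_const _) (fun n ↦ Eventually.of_forall fun x ↦ g.norm_coe_le_norm _)
      (Eventually.of_forall fun x ↦ (g.continuous.tendsto x).comp (hf x))
    exact (g.continuous.measurable.comp (f n).measurable).aestronglyMeasurable
  · have hempty : f n ⁻¹' F = ∅ :=
      eq_empty_of_forall_notMem fun x ↦ SimpleFunc.approxOn_mem measurable_id hy n x
    simp [Annihilator, Measure.map_apply (f n).measurable hF, hempty]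

open Filter in
theorem isOpen_setOf_measure_lt_of_isClosed {X : Type*} [TopologicalSpace X]
    [MeasurableSpace X] [OpensMeasurableSpace X] [HasOuterApproxClosed X] {F : Set X}
    (hF : IsClosed F) (ε : ℝ≥0∞) : IsOpen {μ : ProbabilityMeasure X | μ.toMeasure F < ε} :=
  isOpen_iff_mem_nhds.2 fun _ hμ ↦ eventually_lt_of_limsup_lt
    ((ProbabilityMeasure.limsup_measure_closed_le_of_tendsto tendsto_id hF).trans_lt hμ)

theorem residuallyNull_of_isClosed_of_dense_compl {X : Type*} [TopologicalSpace X]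
    [PolishSpace X] [MeasurableSpace X] [BorelSpace X] {F : Set X} (hF : IsClosed F)
    (hd : Dense Fᶜ) : ResiduallyNull F := by
  have hopen (n : ℕ) :
      {μ : ProbabilityMeasure X | μ.toMeasure F < (n : ℝ≥0∞)⁻¹} ∈ residual _ := by
    refine residual_of_dense_open (isOpen_setOf_measure_lt_of_isClosed hF _)
      ((dense_annihilator_of_dense_compl hF.measurableSet hd).mono fun μ hμ ↦ ?_)
    have h0 : μ.toMeasure F = 0 := hμ
    simp [h0]
  refine Filter.mem_of_superset (countable_iInter_mem.2 hopen) fun μ hμ ↦ ?_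
  by_contra h
  obtain ⟨n, hn⟩ := ENNReal.exists_inv_nat_lt h
  exact (mem_iInter.1 hμ n).not_gt hn

theorem ResiduallyNull.mono {X : Type*} [TopologicalSpace X] [MeasurableSpace X]
    [OpensMeasurableSpace X] {A B : Set X} (hB : ResiduallyNull B) (h : A ⊆ B) :
    ResiduallyNull A :=
  Filter.mem_of_superset hB fun _ hμ ↦ measure_mono_null h hμ

theorem ResiduallyNull.union {X : Type*} [TopologicalSpace X] [MeasurableSpace X]
    [OpensMeasurableSpace X] {A B : Set X} (hA : ResiduallyNull A) (hB : ResiduallyNull B) :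
    ResiduallyNull (A ∪ B) :=
  Filter.mem_of_superset (Filter.inter_mem hA hB) fun _ hμ ↦ measure_union_null hμ.1 hμ.2

theorem ResiduallyNull.sUnion {X : Type*} [TopologicalSpace X] [MeasurableSpace X]
    [OpensMeasurableSpace X] {S : Set (Set X)} (hS : S.Countable)
    (h : ∀ A ∈ S, ResiduallyNull A) : ResiduallyNull (⋃₀ S) :=
  Filter.mem_of_superset ((countable_bInter_mem hS).2 h) fun _ hμ ↦
    (measure_sUnion_null_iff hS).2 fun A hA ↦ mem_iInter₂.1 hμ A hA

theorem isOpen_rOp {X : Type*} [TopologicalSpace X] [MeasurableSpace X]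
    [OpensMeasurableSpace X] (A : Set X) : IsOpen (ROp A) :=
  isOpen_sUnion fun _ hU ↦ hU.1

theorem residuallyNull_rOp_inter {X : Type*} [TopologicalSpace X] [SecondCountableTopology X]
    [MeasurableSpace X] [OpensMeasurableSpace X] (A : Set X) : ResiduallyNull (ROp A ∩ A) := by
  obtain ⟨T, hT, hTS, hTU⟩ := TopologicalSpace.isOpen_sUnion_countable
    {U : Set X | IsOpen U ∧ ResiduallyNull (U ∩ A)} fun _ hU ↦ hU.1
  have hnull : ResiduallyNull (⋃₀ ((· ∩ A) '' T)) :=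
    .sUnion (hT.image _) (forall_mem_image.2 fun U hU ↦ (hTS hU).2)
  refine hnull.mono ?_
  rw [ROp, ← hTU]
  rintro x ⟨⟨U, hU, hxU⟩, hxA⟩
  exact ⟨U ∩ A, mem_image_of_mem _ hU, hxU, hxA⟩

/-- `CR(A)` equals the closure of its interior: `CR(A) = cl(int(CR(A)))`. -/
theorem crop_eq_closure_interior {X : Type*} [TopologicalSpace X] [PolishSpace X]
    [MeasurableSpace X] [BorelSpace X] (A : Set X) :
    CROp A = closure (interior (CROp A)) := by
  have hC : IsClosed (CROp A) := (isOpen_rOp A).isClosed_compl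
  refine Subset.antisymm ?_ hC.closure_interior_subset
  have hfr : ResiduallyNull (frontier (CROp A)) :=
    residuallyNull_of_isClosed_of_dense_compl isClosed_frontier
      (interior_eq_empty_iff_dense_compl.1 (interior_frontier hC))
  rw [← compl_subset_compl]
  intro x hx
  rw [CROp, compl_compl]
  refine ⟨_, ⟨isClosed_closure.isOpen_compl,
    ((residuallyNull_rOp_inter A).union hfr).mono ?_⟩, hx⟩
  rintro y ⟨hy, hyA⟩
  by_cases hyR : y ∈ ROp A
  · exact Or.inl ⟨hyR, hyA⟩
  · exact Or.inr ⟨subset_closure hyR, fun hyI ↦ hy (subset_closure hyI)⟩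
end
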